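/- The function g⁺(p,q) := ℋ(p) + ℋ(q) − ℋ(p∗q) is nondecreasing on [0,1/2]², i.e., if 0 ≤ p ≤ p' ≤ 1/2 and 0 ≤ q ≤ q' ≤ 1/2 then ℋ(p) + ℋ(q) − ℋ(p∗q) ≤ ℋ(p') + ℋ(q') − ℋ(p'∗q'). -/

import Mathlib

open Real

/-- The binary entropy function `ℋ(p) = -p log₂ p - (1-p) log₂ (1-p)`. -/
noncomputable def binH (p : ℝ) : ℝ := -(p * Real.logb 2 p) - (1 - p) * Real.logb 2 (1 - p)

/-- The convolution `p ∗ q = pq + (1-p)(1-q)`. -/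
noncomputable def pstar (p q : ℝ) : ℝ := p * q + (1 - p) * (1 - q)

lemma binH_eq (p : ℝ) : binH p = binEntropy p / Real.log 2 := by
  rw [binEntropy_eq_negMulLog_add_negMulLog_one_sub]
  simp only [binH, Real.logb, negMulLog]
  ring

lemma binH_one_sub' (p : ℝ) : binH (1 - p) = binH p := by
  rw [binH_eq, binH_eq, binEntropy_one_sub]

lemma ent_mono (q : ℝ) (hq0 : 0 ≤ q) (hq2 : q ≤ 1/2) :
    MonotoneOn (fun p => binEntropy p - binEntropy (q + (1 - 2 * q) * p)) (Set.Icc 0 (1/2)) := by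
  have key : ∀ p ∈ Set.Ioo (0:ℝ) (1/2),
      HasDerivAt (fun p => binEntropy p - binEntropy (q + (1 - 2 * q) * p))
        ((log (1 - p) - log p) - (log (1 - (q + (1 - 2 * q) * p)) - log (q + (1 - 2 * q) * p))
          * (1 - 2 * q)) p ∧
      0 ≤ (log (1 - p) - log p) - (log (1 - (q + (1 - 2 * q) * p)) - log (q + (1 - 2 * q) * p))
          * (1 - 2 * q) := by
    rintro p ⟨h0, h1⟩
    have hr1 : p ≤ q + (1 - 2 * q) * p := by nlinarith
    have hr2 : q + (1 - 2 * q) * p ≤ 1/2 := by nlinarith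
    have hd : HasDerivAt (fun p : ℝ => q + (1 - 2 * q) * p) (1 - 2 * q) p := by
      simpa using ((hasDerivAt_id p).const_mul (1 - 2 * q)).const_add q
    constructor
    · have hb := hasDerivAt_binEntropy (p := q + (1 - 2 * q) * p) (by linarith) (by linarith)
      have hc : HasDerivAt (fun p => binEntropy (q + (1 - 2 * q) * p)) _ p :=
        HasDerivAt.comp (h₂ := binEntropy) p hb hd
      exact (hasDerivAt_binEntropy (by linarith) (by linarith)).sub
        hc
    · generalize q + (1 - 2 * q) * p = r at *
      have a1 : log p ≤ log r := log_le_log h0 hr1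
      have a2 : log (1 - r) ≤ log (1 - p) := log_le_log (by linarith) (by linarith)
      have a3 : log r ≤ log (1 - r) := log_le_log (by linarith) (by linarith)
      nlinarith [mul_nonneg (sub_nonneg.2 a3) hq0]
  apply monotoneOn_of_deriv_nonneg (convex_Icc _ _)
  · have := binEntropy_continuous
    exact Continuous.continuousOn (by fun_prop)
  · rw [interior_Icc]
    intro p hp
    exact (key p hp).1.differentiableAt.differentiableWithinAt
  · rw [interior_Icc]
    intro p hp
    rw [(key p hp).1.deriv]
    exact (key p hp).2

lemma step (p p' q : ℝ) (hp0 : 0 ≤ p) (hpp : p ≤ p') (hp2 : p' ≤ 1/2)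
    (hq0 : 0 ≤ q) (hq2 : q ≤ 1/2) :
    binH p - binH (pstar p q) ≤ binH p' - binH (pstar p' q) := by
  have h := ent_mono q hq0 hq2 ⟨hp0, hpp.trans hp2⟩ ⟨hp0.trans hpp, hp2⟩ hpp
  have e : ∀ x, binH (pstar x q) = binH (q + (1 - 2 * q) * x) := by
    intro x
    rw [← binH_one_sub']
    congr 1
    unfold pstar
    ring
  rw [e, e]
  simp only [binH_eq, ← sub_div]
  exact div_le_div_of_nonneg_right h (log_nonneg (by norm_num))

/-- The function `g⁺(p,q) = ℋ(p) + ℋ(q) - ℋ(p∗q)` is nondecreasing on `[0,1/2]²`. -/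
theorem gplus_monotone
    (p p' q q' : ℝ) (hp0 : 0 ≤ p) (hpp : p ≤ p') (hp2 : p' ≤ 1/2)
    (hq0 : 0 ≤ q) (hqq : q ≤ q') (hq2 : q' ≤ 1/2) :
    binH p + binH q - binH (pstar p q) ≤ binH p' + binH q' - binH (pstar p' q') := by
  have h1 := step p p' q hp0 hpp hp2 hq0 (hqq.trans hq2)
  have h2 := step q q' p' hq0 hqq hq2 (hp0.trans hpp) hp2
  have e : ∀ x y, pstar x y = pstar y x := by
    intro x y
    unfold pstar
    ring
  rw [e q p', e q' p'] at h2
  linarith
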